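/- arXiv:math/9904042 — 2 statements merged into one kernel-verified Lean document; each statement's English description precedes it below -/
import Mathlib

section
/- Let p, q ≥ 1 be integers and let x ∈ ℝ^p, y ∈ ℝ^q satisfy |x_i| < 1 for all i and |y_j| < 1 for all j. For i ∈ ℤ set A_i := ∑_{ℓ=0}^∞ h_{ℓ+i}(x)·h_ℓ(y) (the series converges absolutely). Then the Toeplitz determinants converge: lim_{n→∞} det( (A_{i−j})_{1≤i,j≤n} ) = ∏_{i=1}^p ∏_{j=1}^q (1 − x_i y_j)^{−1}. -/
open scoped BigOperators Topology

/-- The complete homogeneous symmetric polynomial `h_r` in the variables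
`x_1, …, x_p`, evaluated at `x`, with `h_r = 0` for `r < 0`. -/
noncomputable def hpoly {p : ℕ} (x : Fin p → ℝ) (r : ℤ) : ℝ :=
  if 0 ≤ r then ∑ d ∈ Finset.Nat.antidiagonalTuple p r.toNat, ∏ i, x i ^ d i
  else 0

lemma hpoly_neg {p : ℕ} (x : Fin p → ℝ) {r : ℤ} (hr : r < 0) : hpoly x r = 0 := by
  simp [hpoly, not_le.mpr hr]

lemma hpoly_nat {p : ℕ} (x : Fin p → ℝ) (n : ℕ) :
    hpoly x (n : ℤ) = ∑ d ∈ Finset.Nat.antidiagonalTuple p n, ∏ i, x i ^ d i := by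
  simp [hpoly]

lemma hpoly_zero_right {p : ℕ} (x : Fin p → ℝ) : hpoly x 0 = 1 := by
  simp [hpoly, Finset.Nat.antidiagonalTuple_zero_right]

lemma hpoly_fin_zero (x : Fin 0 → ℝ) (r : ℤ) : hpoly x r = if r = 0 then 1 else 0 := by
  rcases lt_trichotomy r 0 with h | h | h
  · rw [hpoly_neg x h, if_neg h.ne]
  · subst h; simp [hpoly_zero_right]
  · rw [if_neg h.ne']
    obtain ⟨n, rfl⟩ : ∃ n : ℕ, r = ((n + 1 : ℕ) : ℤ) := ⟨r.toNat - 1, by omega⟩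
    rw [hpoly_nat]
    simp [Finset.Nat.antidiagonalTuple_zero_succ]

lemma hpoly_conv {p : ℕ} (x : Fin (p + 1) → ℝ) (n : ℕ) :
    hpoly x (n : ℤ) = ∑ kl ∈ Finset.HasAntidiagonal.antidiagonal n,
      x 0 ^ kl.1 * hpoly (Fin.tail x) (kl.2 : ℤ) := by
  simp only [hpoly_nat, Finset.mul_sum]
  rw [Finset.sum_sigma']
  refine Finset.sum_bij' (fun d _ => ⟨(d 0, ∑ i, Fin.tail d i), Fin.tail d⟩)
    (fun s _ => Fin.cons s.1.1 s.2) ?_ ?_ ?_ ?_ ?_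
  · intro d hd
    rw [Finset.Nat.mem_antidiagonalTuple, Fin.sum_univ_succ] at hd
    simp [Finset.Nat.mem_antidiagonalTuple, Fin.tail, hd]
  · rintro ⟨⟨a, b⟩, e⟩ hs
    simp only [Finset.mem_sigma, Finset.HasAntidiagonal.mem_antidiagonal,
      Finset.Nat.mem_antidiagonalTuple] at hs
    simp [Finset.Nat.mem_antidiagonalTuple, Fin.sum_univ_succ, hs]
  · intro d _
    simp
  · rintro ⟨⟨a, b⟩, e⟩ hs
    simp only [Finset.mem_sigma, Finset.HasAntidiagonal.mem_antidiagonal,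
      Finset.Nat.mem_antidiagonalTuple] at hs
    obtain ⟨_, rfl⟩ := hs
    simp
  · intro d _
    simp [Fin.prod_univ_succ, Fin.tail]

lemma hpoly_rec {p : ℕ} (x : Fin (p + 1) → ℝ) (r : ℤ) :
    hpoly x r = hpoly (Fin.tail x) r + x 0 * hpoly x (r - 1) := by
  rcases lt_trichotomy r 0 with h | h | h
  · rw [hpoly_neg x h, hpoly_neg _ h, hpoly_neg x (by omega)]; simp
  · subst h
    rw [hpoly_zero_right, hpoly_zero_right, hpoly_neg x (by omega)]; simp
  · obtain ⟨n, rfl⟩ : ∃ n : ℕ, r = ((n + 1 : ℕ) : ℤ) := ⟨r.toNat - 1, by omega⟩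
    have : (((n + 1 : ℕ) : ℤ) - 1) = (n : ℤ) := by push_cast; ring
    rw [this, hpoly_conv, hpoly_conv, Finset.Nat.sum_antidiagonal_succ, Finset.mul_sum]
    simp only [pow_zero, one_mul]
    congr 1
    refine Finset.sum_congr rfl fun kl _ => ?_
    ring

lemma hpoly_summable : ∀ {p : ℕ} (x : Fin p → ℝ), (∀ i, |x i| < 1) →
    Summable fun n : ℕ => ‖hpoly x (n : ℤ)‖
  | 0, x, _ => by
    refine summable_of_ne_finset_zero (s := {0}) fun n hn => ?_
    have : n ≠ 0 := by simpa using hn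
    simp [hpoly_fin_zero, this]
  | p + 1, x, hx => by
    have h1 : Summable fun n : ℕ => ‖x 0 ^ n‖ := by
      simp only [norm_pow]
      exact summable_geometric_of_lt_one (norm_nonneg _) (hx 0)
    have := summable_norm_sum_mul_antidiagonal_of_summable_norm h1
      (hpoly_summable (Fin.tail x) fun i => hx i.succ)
    simpa only [hpoly_conv] using this

lemma hpoly_bdd {p : ℕ} (x : Fin p → ℝ) (hx : ∀ i, |x i| < 1) :
    ∃ M, ∀ r : ℤ, ‖hpoly x r‖ ≤ M := by
  refine ⟨∑' n : ℕ, ‖hpoly x (n : ℤ)‖, fun r => ?_⟩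
  by_cases hr : r < 0
  · rw [hpoly_neg x hr, norm_zero]
    exact tsum_nonneg fun _ => norm_nonneg _
  · obtain ⟨n, rfl⟩ : ∃ n : ℕ, r = n := ⟨r.toNat, by omega⟩
    exact (hpoly_summable x hx).le_tsum n fun _ _ => norm_nonneg _

/-- The Toeplitz coefficients. -/
noncomputable def tcoef {p q : ℕ} (x : Fin p → ℝ) (y : Fin q → ℝ) (i : ℤ) : ℝ :=
  ∑' ℓ : ℕ, hpoly x ((ℓ : ℤ) + i) * hpoly y (ℓ : ℤ)

lemma tcoef_summable {p q : ℕ} (x : Fin p → ℝ) (y : Fin q → ℝ)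
    (hx : ∀ i, |x i| < 1) (hy : ∀ j, |y j| < 1) (i : ℤ) :
    Summable fun ℓ : ℕ => hpoly x ((ℓ : ℤ) + i) * hpoly y (ℓ : ℤ) := by
  obtain ⟨M, hM⟩ := hpoly_bdd x hx
  refine Summable.of_norm_bounded ((hpoly_summable y hy).mul_left M) fun ℓ => ?_
  rw [norm_mul]
  exact mul_le_mul_of_nonneg_right (hM _) (norm_nonneg _)

lemma tcoef_rec_left {p q : ℕ} (x : Fin (p + 1) → ℝ) (y : Fin q → ℝ)
    (hx : ∀ i, |x i| < 1) (hy : ∀ j, |y j| < 1) (i : ℤ) :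
    tcoef x y i = tcoef (Fin.tail x) y i + x 0 * tcoef x y (i - 1) := by
  unfold tcoef
  rw [← tsum_mul_left, ← Summable.tsum_add
    (tcoef_summable (Fin.tail x) y (fun i => hx i.succ) hy i)
    ((tcoef_summable x y hx hy (i - 1)).mul_left _)]
  refine tsum_congr fun ℓ => ?_
  rw [hpoly_rec x, show (ℓ : ℤ) + i - 1 = ℓ + (i - 1) by ring]
  ring

lemma tcoef_rec_right {p q : ℕ} (x : Fin p → ℝ) (y : Fin (q + 1) → ℝ)
    (hx : ∀ i, |x i| < 1) (hy : ∀ j, |y j| < 1) (i : ℤ) :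
    tcoef x y i = tcoef x (Fin.tail y) i + y 0 * tcoef x y (i + 1) := by
  have h0 : Summable fun ℓ : ℕ => hpoly x ((ℓ : ℤ) + i) * hpoly y ((ℓ : ℤ) - 1) := by
    rw [← summable_nat_add_iff 1]
    refine (tcoef_summable x y hx hy (i + 1)).congr fun ℓ => ?_
    push_cast
    rw [show (ℓ : ℤ) + 1 + i = ℓ + (i + 1) by ring, show (ℓ : ℤ) + 1 - 1 = ℓ by ring]
  have h1 : tcoef x y (i + 1) = ∑' ℓ : ℕ, hpoly x ((ℓ : ℤ) + i) * hpoly y ((ℓ : ℤ) - 1) := by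
    rw [h0.tsum_eq_zero_add, hpoly_neg y (by simp), mul_zero, zero_add]
    refine tsum_congr fun ℓ => ?_
    push_cast
    rw [show (ℓ : ℤ) + 1 + i = ℓ + (i + 1) by ring, show (ℓ : ℤ) + 1 - 1 = ℓ by ring]
  rw [h1]
  unfold tcoef
  rw [← tsum_mul_left, ← Summable.tsum_add
    (tcoef_summable x (Fin.tail y) hx (fun i => hy i.succ) i) (h0.mul_left _)]
  refine tsum_congr fun ℓ => ?_
  rw [hpoly_rec y]
  ring

lemma tcoef_zero_left {q : ℕ} (x : Fin 0 → ℝ) (y : Fin q → ℝ) (i : ℤ) (hi : 1 ≤ i) :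
    tcoef x y i = 0 := by
  unfold tcoef
  refine (tsum_congr fun ℓ => ?_).trans tsum_zero
  rw [hpoly_fin_zero, if_neg (by omega), zero_mul]

lemma tcoef_zero_right {p : ℕ} (x : Fin p → ℝ) (y : Fin 0 → ℝ) (i : ℤ) :
    tcoef x y i = hpoly x i := by
  unfold tcoef
  rw [tsum_eq_single 0]
  · simp [hpoly_zero_right]
  · intro ℓ hℓ
    simp [hpoly_fin_zero, hℓ]

/-- The shift operator on bi-infinite sequences. -/
noncomputable def shiftOp : Module.End ℝ (ℤ → ℝ) where
  toFun f i := f (i - 1)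
  map_add' _ _ := rfl
  map_smul' _ _ := rfl

lemma shiftOp_apply (f : ℤ → ℝ) (i : ℤ) : shiftOp f i = f (i - 1) := rfl

lemma shiftOp_pow_apply (m : ℕ) (f : ℤ → ℝ) (i : ℤ) : (shiftOp ^ m) f i = f (i - m) := by
  induction m generalizing i with
  | zero => simp
  | succ m ih =>
    rw [pow_succ', Module.End.mul_apply, shiftOp_apply, ih]
    push_cast
    congr 1
    ring

open Polynomial in
lemma aeval_shift_apply (P : ℝ[X]) (n : ℕ) (hn : P.natDegree < n) (f : ℤ → ℝ) (i : ℤ) :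
    (aeval shiftOp P) f i = ∑ m : Fin n, P.coeff m * f (i - (m : ℕ)) := by
  rw [aeval_eq_sum_range' hn, Fin.sum_univ_eq_sum_range (fun m => P.coeff m * f (i - (m : ℕ)))]
  simp [LinearMap.sum_apply, Finset.sum_apply, shiftOp_pow_apply]

open Polynomial in
lemma tcoef_annihilate {q : ℕ} (y : Fin q → ℝ) (hy : ∀ j, |y j| < 1) :
    ∀ {p : ℕ} (x : Fin p → ℝ), (∀ i, |x i| < 1) → ∀ i : ℤ, 1 ≤ i →
      (aeval shiftOp (∏ k, (1 - C (x k) * X : ℝ[X]))) (tcoef x y) i = 0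
  | 0, x, _, i, hi => by simp [tcoef_zero_left x y i hi]
  | p + 1, x, hx, i, hi => by
    have h := tcoef_annihilate y hy (Fin.tail x) (fun i => hx i.succ) i hi
    rw [Fin.prod_univ_succ, mul_comm, map_mul, Module.End.mul_apply]
    have : (aeval shiftOp (1 - C (x 0) * X : ℝ[X])) (tcoef x y) = tcoef (Fin.tail x) y := by
      funext i
      have := tcoef_rec_left x y hx hy i
      simp [shiftOp_apply, Module.algebraMap_end_apply]
      linarith
    rw [this]
    exact h

open Polynomial in
lemma det_step (A B : ℤ → ℝ) (y : ℝ) (P : ℝ[X]) (n : ℕ) (hPn : P.natDegree ≤ n + 1)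
    (hP0 : P.eval 0 = 1) (hAB : ∀ i, B i = A i + y * B (i + 1))
    (hB : ∀ i : ℤ, 1 ≤ i → (aeval shiftOp P) B i = 0) :
    P.eval y * Matrix.det (Matrix.of fun i j : Fin (n + 1) =>
        B (((i : ℕ) : ℤ) - ((j : ℕ) : ℤ))) =
      Matrix.det (Matrix.of fun i j : Fin (n + 1) => A (((i : ℕ) : ℤ) - ((j : ℕ) : ℤ))) := by
  obtain ⟨G, hG⟩ := X_sub_C_dvd_sub_C_eval (a := y) (p := P)
  have hGdeg : G.natDegree ≤ n := by
    by_cases hG0 : G = 0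
    · simp [hG0]
    have h1 : ((X - C y) * G).natDegree = 1 + G.natDegree := by
      rw [natDegree_mul (X_sub_C_ne_zero y) hG0, natDegree_X_sub_C]
    rw [← hG, natDegree_sub_C] at h1
    omega
  have hshift : aeval shiftOp (X - C y) B = shiftOp A := by
    funext i
    have := hAB (i - 1)
    simp [shiftOp_apply, Module.algebraMap_end_apply] at this ⊢
    linarith
  have key1 : ∀ i : ℤ, 0 ≤ i → P.eval y * B (i + 1) = - (aeval shiftOp G) A i := by
    intro i hi
    have h := hB (i + 1) (by omega)
    have hP : P = C (P.eval y) + G * (X - C y) := by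
      rw [mul_comm G, ← hG]; ring
    have hcomm : (aeval shiftOp G) (shiftOp A) = shiftOp ((aeval shiftOp G) A) := by
      have : aeval shiftOp (G * X) = aeval shiftOp (X * G) := by rw [mul_comm]
      rw [map_mul, map_mul, aeval_X] at this
      exact congrArg (fun F : Module.End ℝ (ℤ → ℝ) => F A) this
    rw [hP, map_add, map_mul, LinearMap.add_apply, Module.End.mul_apply, hshift, hcomm,
      Pi.add_apply, shiftOp_apply, aeval_C, Module.algebraMap_end_apply, Pi.smul_apply,
      smul_eq_mul, add_sub_cancel_right] at h
    linarith
  set K : ℝ[X] := C (P.eval y) - C y * G with hK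
  have hKdeg : K.natDegree < n + 1 := by
    refine Nat.lt_succ_of_le ((natDegree_sub_le _ _).trans ?_)
    refine max_le (by simp) ((natDegree_C_mul_le _ _).trans hGdeg)
  have hK0 : K.coeff 0 = 1 := by
    have := congrArg (eval 0) hG
    rw [coeff_zero_eq_eval_zero]
    simp [hP0] at this
    simp [hK]
    linarith
  have key2 : ∀ i : ℤ, 0 ≤ i → P.eval y * B i = (aeval shiftOp K) A i := by
    intro i hi
    have h1 := key1 i hi
    rw [hK, map_sub, map_mul, aeval_C, aeval_C, LinearMap.sub_apply, Module.End.mul_apply,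
      Pi.sub_apply, Module.algebraMap_end_apply, Module.algebraMap_end_apply,
      Pi.smul_apply, Pi.smul_apply, smul_eq_mul, smul_eq_mul, hAB i]
    linear_combination y * h1
  set M : Matrix (Fin (n + 1)) (Fin (n + 1)) ℝ :=
    Matrix.of fun i j : Fin (n + 1) => A (((i : ℕ) : ℤ) - ((j : ℕ) : ℤ)) with hM
  have hdet : Matrix.det (Matrix.of fun i j : Fin (n + 1) =>
        B (((i : ℕ) : ℤ) - ((j : ℕ) : ℤ))) =
      (M.updateCol 0 fun i => B ((i : ℕ) : ℤ)).det := by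
    refine Matrix.det_eq_of_forall_col_eq_smul_add_pred (fun _ => y) ?_ ?_
    · intro i
      simp
    · intro i j
      rw [Matrix.updateCol_ne (Fin.succ_ne_zero j)]
      simp only [hM, Matrix.of_apply, Fin.val_succ, Fin.val_castSucc]
      rw [hAB]
      congr 3
      push_cast
      ring
  rw [hdet, ← Matrix.det_updateCol_smul]
  have := Matrix.det_updateCol_sum M 0 (fun j => K.coeff (j : ℕ))
  simp only [Fin.val_zero, hK0, one_smul] at this
  rw [← this]
  congr 2
  funext i
  rw [Pi.smul_apply, smul_eq_mul, key2 _ (by omega), aeval_shift_apply K (n + 1) hKdeg]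
  simp [hM]

open Polynomial in
lemma det_eq {p : ℕ} (x : Fin p → ℝ) (hx : ∀ i, |x i| < 1) (n : ℕ) (hn : p ≤ n + 1) :
    ∀ {q : ℕ} (y : Fin q → ℝ), (∀ j, |y j| < 1) →
      Matrix.det (Matrix.of fun i j : Fin (n + 1) =>
        tcoef x y (((i : ℕ) : ℤ) - ((j : ℕ) : ℤ))) = ∏ j, ∏ i, (1 - x i * y j)⁻¹
  | 0, y, _ => by
    rw [Matrix.det_of_lowerTriangular]
    · simp [tcoef_zero_right, hpoly_zero_right]
    · intro i j hij
      have hij' : i < j := hij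
      rw [Matrix.of_apply, tcoef_zero_right, hpoly_neg]
      have : (i : ℕ) < j := hij'
      omega
  | q + 1, y, hy => by
    have ih := det_eq x hx n hn (Fin.tail y) (fun j => hy j.succ)
    have hs := det_step (tcoef x (Fin.tail y)) (tcoef x y) (y 0)
      (∏ k, (1 - C (x k) * X : ℝ[X])) n ?_ ?_ (tcoef_rec_right x y hx hy)
      (tcoef_annihilate y hy x hx)
    · rw [ih] at hs
      have hev : (∏ k, (1 - C (x k) * X : ℝ[X])).eval (y 0) = ∏ k, (1 - x k * y 0) := by
        simp [eval_prod]
      rw [hev] at hs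
      have hne : ∏ k, (1 - x k * y 0) ≠ 0 := by
        refine Finset.prod_ne_zero_iff.mpr fun k _ => ?_
        have h1 : |x k * y 0| < 1 := by
          rw [abs_mul]
          exact mul_lt_one_of_nonneg_of_lt_one_left (abs_nonneg _) (hx k) (hy 0).le
        have := (abs_lt.mp h1).2
        linarith
      rw [Fin.prod_univ_succ, Finset.prod_inv_distrib, eq_inv_mul_iff_mul_eq₀ hne, hs]
      rfl
    · refine (natDegree_prod_le _ _).trans (le_trans ?_ hn)
      refine (Finset.sum_le_card_nsmul _ _ 1 fun k _ => ?_).trans (by simp)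
      refine (natDegree_sub_le _ _).trans (max_le (by simp) ?_)
      exact (natDegree_C_mul_le _ _).trans natDegree_X_le
    · simp [eval_prod]

/-- Szegő limit / Cauchy identity: for `|x_i| < 1`, `|y_j| < 1`, the `n × n`
Toeplitz determinants with entries `A_{i-j}`, `A_i = ∑_{ℓ ≥ 0} h_{ℓ+i}(x) h_ℓ(y)`,
converge as `n → ∞` to `∏_{i,j} (1 - x_i y_j)⁻¹`. -/
theorem toeplitz_det_tendsto_cauchy (p q : ℕ) (hp : 1 ≤ p) (hq : 1 ≤ q)
    (x : Fin p → ℝ) (y : Fin q → ℝ)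
    (hx : ∀ i, |x i| < 1) (hy : ∀ j, |y j| < 1) :
    Filter.Tendsto
      (fun n : ℕ =>
        Matrix.det (Matrix.of fun i j : Fin n =>
          ∑' ℓ : ℕ, hpoly x ((ℓ : ℤ) + (((i : ℕ) : ℤ) - ((j : ℕ) : ℤ))) *
            hpoly y (ℓ : ℤ)))
      Filter.atTop
      (𝓝 (∏ i, ∏ j, (1 - x i * y j)⁻¹)) := by
  refine tendsto_const_nhds.congr' ?_
  filter_upwards [Filter.eventually_ge_atTop p] with n hn
  obtain ⟨m, rfl⟩ : ∃ m, n = m + 1 := ⟨n - 1, by omega⟩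
  rw [Finset.prod_comm]
  exact (det_eq x hx m hn y hy).symm
end

section
/- Let k ≥ 1, n ≥ 1 be integers, let D_n(t) be the n×n Toeplitz determinant with symbol e^{t/z}(1+z)^k, and set σ(t) := k t − t·D_n′(t)/D_n(t), which is defined and smooth in a neighborhood of t = 0 since D_n(0) = 1. Then σ(t) = (k/(n+1)!)·C(n+k, n)·t^{n+1} + O(t^{n+2}) as t → 0; precisely, lim_{t→0} σ(t)/t^{n+1} = (k/(n+1)!)·C(n+k, n), where C(n+k,n) is the binomial coefficient. -/
open scoped BigOperators Topology

/-- The Fourier coefficients `a_j(t)` of the symbol `e^{t/z} (1+z)^k`. -/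
noncomputable def aCoeff (k : ℕ) (j : ℤ) (t : ℝ) : ℝ :=
  ∑' ℓ : ℕ, t ^ ℓ / (Nat.factorial ℓ : ℝ) *
    (if 0 ≤ j + (ℓ : ℤ) then (Nat.choose k (j + (ℓ : ℤ)).toNat : ℝ) else 0)

/-- `D_n(t)`: the `n × n` Toeplitz determinant with symbol `e^{t/z} (1+z)^k`. -/
noncomputable def Dn (k n : ℕ) (t : ℝ) : ℝ :=
  Matrix.det (Matrix.of fun i j : Fin n =>
    aCoeff k (((i : ℕ) : ℤ) - ((j : ℕ) : ℤ)) t)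

/-- `σ(t) = k t - t D_n'(t)/D_n(t)`. -/
noncomputable def sigmaFn (k n : ℕ) (t : ℝ) : ℝ :=
  (k : ℝ) * t - t * deriv (Dn k n) t / Dn k n t


open Filter Finset Matrix

/-- binomial coefficient extended by zero to negative lower index -/
noncomputable def cc (k : ℕ) (m : ℤ) : ℝ := if 0 ≤ m then (Nat.choose k m.toNat : ℝ) else 0

lemma cc_of_lt (k : ℕ) (m : ℤ) (h : (k : ℤ) < m) : cc k m = 0 := by
  unfold cc
  split_ifs
  · rw [Nat.choose_eq_zero_of_lt (by omega)]; simp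
  · rfl

/-- truncated exponential-type sum -/
noncomputable def pA (c : ℤ → ℝ) (K : ℕ) (j : ℤ) (t : ℝ) : ℝ :=
  ∑ l ∈ range K, t ^ l / (Nat.factorial l : ℝ) * c (j + l)

lemma aCoeff_eq (k K : ℕ) (j : ℤ) (t : ℝ) (h : (k : ℤ) < j + K) :
    aCoeff k j t = pA (cc k) K j t := by
  unfold aCoeff pA
  rw [tsum_eq_sum (s := range K)]
  · rfl
  · intro l hl
    have : cc k (j + l) = 0 := cc_of_lt _ _ (by simp at hl; omega)
    unfold cc at this
    rw [this, mul_zero]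

lemma pA_hasDerivAt (c : ℤ → ℝ) (K : ℕ) (j : ℤ) (t : ℝ) :
    HasDerivAt (pA c (K + 1) j) (pA c K (j + 1) t) t := by
  have h : ∀ l ∈ range (K + 1), HasDerivAt (fun t : ℝ => t ^ l / (Nat.factorial l : ℝ) * c (j + l))
      ((l : ℝ) * t ^ (l - 1) / (Nat.factorial l : ℝ) * c (j + l)) t := by
    intro l _
    exact ((hasDerivAt_pow l t).div_const _).mul_const _
  have h2 := HasDerivAt.fun_sum h
  refine h2.congr_deriv ?_
  rw [sum_range_succ']
  unfold pA
  simp only [CharP.cast_eq_zero, zero_mul, zero_div, add_zero]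
  refine sum_congr rfl fun l _ => ?_
  have e : j + 1 + (l : ℤ) = j + ((l + 1 : ℕ) : ℤ) := by push_cast; ring
  rw [e, Nat.factorial_succ]
  have : (Nat.factorial l : ℝ) ≠ 0 := by positivity
  have : ((l : ℝ) + 1) ≠ 0 := by positivity
  push_cast
  have e2 : l + 1 - 1 = l := by omega
  try rw [e2]
  field_simp

lemma aCoeff_hasDerivAt (k : ℕ) (j : ℤ) (t : ℝ) :
    HasDerivAt (aCoeff k j) (aCoeff k (j + 1) t) t := by
  obtain ⟨K, hK⟩ : ∃ K : ℕ, (k : ℤ) < j + K := ⟨(k - j).toNat + 1, by omega⟩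
  have e : aCoeff k j = pA (cc k) (K + 1) j := by
    funext s; exact aCoeff_eq k _ j s (by push_cast; omega)
  rw [e, aCoeff_eq k K (j + 1) t (by omega)]
  exact pA_hasDerivAt _ _ _ _

lemma pA_tendsto (c : ℤ → ℝ) (K : ℕ) (j : ℤ) (p : ℕ) (hp : p < K)
    (h0 : ∀ l < p, c (j + l) = 0) :
    Tendsto (fun t : ℝ => pA c K j t / t ^ p) (𝓝[≠] (0 : ℝ))
      (𝓝 (c (j + p) / (Nat.factorial p : ℝ))) := by
  have h : ∀ l ∈ range K, Tendsto (fun t : ℝ => t ^ l / (Nat.factorial l : ℝ) * c (j + l) / t ^ p)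
      (𝓝[≠] (0 : ℝ)) (𝓝 (if l = p then c (j + p) / (Nat.factorial p : ℝ) else 0)) := by
    intro l _
    rcases lt_trichotomy l p with hl | hl | hl
    · simp [h0 l hl, hl.ne]
    · subst hl
      simp only [if_true]
      refine (tendsto_const_nhds).congr' ?_
      filter_upwards [self_mem_nhdsWithin] with t ht
      have : t ^ l ≠ 0 := pow_ne_zero _ ht
      field_simp
    · rw [if_neg hl.ne']
      obtain ⟨q, rfl⟩ := Nat.exists_eq_add_of_lt hl
      have : Tendsto (fun t : ℝ => t ^ (q + 1) * (c (j + ((p + q + 1 : ℕ) : ℤ)) / (Nat.factorial (p + q + 1) : ℝ)))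
          (𝓝[≠] (0 : ℝ)) (𝓝 0) := by
        have : Continuous (fun t : ℝ => t ^ (q + 1) * (c (j + ((p + q + 1 : ℕ) : ℤ)) / (Nat.factorial (p + q + 1) : ℝ))) := by fun_prop
        have := this.tendsto 0
        simp only [zero_pow (Nat.succ_ne_zero q), zero_mul] at this
        exact this.mono_left nhdsWithin_le_nhds
      refine this.congr' ?_
      filter_upwards [self_mem_nhdsWithin] with t ht
      have : t ^ p ≠ 0 := pow_ne_zero _ ht
      have e : t ^ (p + q + 1) = t ^ p * t ^ (q + 1) := by rw [add_assoc, pow_add]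
      rw [e]
      field_simp
  have h2 := tendsto_finsetSum _ h
  rw [sum_ite_eq' (range K) p, if_pos (mem_range.2 hp)] at h2
  refine h2.congr fun t => ?_
  unfold pA
  rw [sum_div]

lemma det_hasDerivAt {m : ℕ} (A : ℝ → Matrix (Fin m) (Fin m) ℝ) (A' : Matrix (Fin m) (Fin m) ℝ)
    (t : ℝ) (h : ∀ i j, HasDerivAt (fun s => A s i j) (A' i j) t) :
    HasDerivAt (fun s => (A s).det) (∑ j, ((A t).updateCol j (fun i => A' i j)).det) t := by
  have key : ∀ σ ∈ (univ : Finset (Equiv.Perm (Fin m))),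
      HasDerivAt (fun s => ((Equiv.Perm.sign σ : ℤ) : ℝ) * ∏ i, A s (σ i) i)
      (((Equiv.Perm.sign σ : ℤ) : ℝ) * ∑ j, (∏ i ∈ univ.erase j, A t (σ i) i) • A' (σ j) j) t := by
    intro σ _
    exact (HasDerivAt.fun_finsetProd (fun i _ => h (σ i) i)).const_mul _
  have h2 := HasDerivAt.fun_sum key
  simp only [det_apply']
  refine h2.congr_deriv ?_
  rw [sum_comm]
  refine sum_congr rfl fun σ _ => ?_
  rw [mul_sum]
  refine sum_congr rfl fun j _ => ?_
  congr 1
  rw [← mul_prod_erase univ (fun i => ((A t).updateCol j fun i => A' i j) (σ i) i) (mem_univ j), smul_eq_mul,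
    mul_comm (∏ i ∈ univ.erase j, A t (σ i) i)]
  congr 1
  · rw [updateCol_self]
  · refine prod_congr rfl fun i hi => ?_
    rw [updateCol_ne (ne_of_mem_erase hi)]

/-- The Toeplitz matrix -/
noncomputable def TM (k N : ℕ) (t : ℝ) : Matrix (Fin (N + 1)) (Fin (N + 1)) ℝ :=
  Matrix.of fun i j => aCoeff k (((i : ℕ) : ℤ) - ((j : ℕ) : ℤ)) t

lemma Dn_hasDerivAt (k N : ℕ) (t : ℝ) :
    HasDerivAt (Dn k (N + 1))
      (((TM k N t).updateCol 0 (fun i => aCoeff k (((i : ℕ) : ℤ) + 1) t)).det) t := by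
  have h := det_hasDerivAt (TM k N)
    (Matrix.of fun i j => aCoeff k (((i : ℕ) : ℤ) - ((j : ℕ) : ℤ) + 1) t) t
    (fun i j => aCoeff_hasDerivAt k _ t)
  rw [Fin.sum_univ_succ] at h
  rw [sum_eq_zero (s := univ) (f := fun i : Fin N => _)] at h
  · have e : Dn k (N + 1) = fun s => (TM k N s).det := rfl
    rw [e]
    simpa using h
  · intro j _
    apply det_zero_of_column_eq (i := j.castSucc) (j := j.succ) 
    · exact Fin.castSucc_lt_succ.ne
    · intro i
      rw [updateCol_ne (Fin.castSucc_lt_succ.ne), updateCol_self]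
      simp only [TM, of_apply, Fin.val_castSucc, Fin.val_succ]
      congr 1
      push_cast; ring

/-- coefficients of `(1+z)^{-k}` -/
noncomputable def ww (k m : ℕ) : ℝ := ((Ring.choose (-(k : ℤ)) m : ℤ) : ℝ)

lemma ww_zero (k : ℕ) : ww k 0 = 1 := by simp [ww]

lemma ww_one (k : ℕ) : ww k 1 = -k := by simp [ww]

lemma ww_eq (k m : ℕ) : ww k (m + 1) = (-1) ^ (m + 1) * (Nat.choose (k + m) (m + 1) : ℝ) := by
  unfold ww
  rw [Ring.choose_neg]
  have : ((k : ℤ) + ((m + 1 : ℕ) : ℤ) - 1) = ((k + m : ℕ) : ℤ) := by push_cast; ring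
  rw [this, Ring.choose_natCast]
  have e : (((m + 1 : ℕ) : ℤ).negOnePow : ℤˣ) = (-1) ^ (m + 1) := by
    rw [Int.negOnePow_def, zpow_natCast]
  rw [e, Units.smul_def]
  push_cast
  simp

lemma ww_conv (k s : ℕ) (hs : s ≠ 0) :
    ∑ m ∈ range (s + 1), ww k m * cc k ((s : ℤ) - m) = 0 := by
  have h := Ring.add_choose_eq (R := ℤ) (r := -(k : ℤ)) (s := (k : ℤ)) s (Commute.all _ _)
  rw [neg_add_cancel, Ring.choose_zero_pos ℤ (Nat.pos_of_ne_zero hs),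
    Nat.sum_antidiagonal_eq_sum_range_succ_mk] at h
  have h' := congrArg (fun x : ℤ => (x : ℝ)) h
  push_cast at h'
  rw [h']
  refine sum_congr rfl fun m hm => ?_
  have : m ≤ s := by simp at hm; omega
  have e : (s : ℤ) - m = ((s - m : ℕ) : ℤ) := by omega
  unfold ww cc
  rw [e, Ring.choose_natCast]
  simp

/-- coefficients of `(1+z)^k` times the truncation of `(1+z)^{-k}` at degree `n` -/
noncomputable def gg (k n : ℕ) (s : ℤ) : ℝ := ∑ m ∈ range (n + 1), ww k m * cc k (s - m)

lemma gg_zero (k n s : ℕ) (hs : s ≠ 0) (hn : s ≤ n) : gg k n s = 0 := by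
  rw [← ww_conv k s hs]
  unfold gg
  symm
  apply sum_subset
  · intro x; simp; omega
  · intro m _ hm
    have : ¬ (0 ≤ (s : ℤ) - m) := by simp at hm; omega
    rw [cc, if_neg this, mul_zero]

lemma gg_succ (k n : ℕ) : gg k n ((n + 1 : ℕ) : ℤ) = - ww k (n + 1) := by
  have h := ww_conv k (n + 1) (by omega)
  rw [sum_range_succ] at h
  simp only [sub_self] at h
  unfold gg
  have : cc k 0 = 1 := by simp [cc]
  rw [this] at h
  linarith

/-- error vector -/
noncomputable def ee (k N : ℕ) (t : ℝ) (i : Fin (N + 1)) : ℝ :=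
  - ∑ m ∈ range (N + 2), ww k m * aCoeff k (((i : ℕ) : ℤ) + 1 - m) t

lemma ee_eq (k N : ℕ) (t : ℝ) (i : Fin (N + 1)) (K : ℕ) (hK : k + N + 1 < K) :
    ee k N t i = - pA (gg k (N + 1)) K (((i : ℕ) : ℤ) + 1) t := by
  unfold ee
  congr 1
  have : ∀ m ∈ range (N + 2), ww k m * aCoeff k (((i : ℕ) : ℤ) + 1 - m) t =
      ww k m * pA (cc k) K (((i : ℕ) : ℤ) + 1 - m) t := by
    intro m hm
    rw [aCoeff_eq k K]
    simp at hm; omega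
  rw [sum_congr rfl this]
  unfold pA gg
  simp only [mul_sum]
  rw [sum_comm]
  refine sum_congr rfl fun l _ => sum_congr rfl fun m _ => ?_
  have : ((i : ℕ) : ℤ) + 1 - m + l = ((i : ℕ) : ℤ) + 1 + l - m := by ring
  rw [this]; ring

lemma ee_tendsto (k N : ℕ) (i : Fin (N + 1)) :
    Tendsto (fun t : ℝ => ee k N t i / t ^ (N + 1 - i : ℕ)) (𝓝[≠] (0 : ℝ))
      (𝓝 (ww k (N + 2) / (Nat.factorial (N + 1 - i) : ℝ))) := by
  have h := pA_tendsto (gg k (N + 1)) (k + N + 2) (((i : ℕ) : ℤ) + 1) (N + 1 - i) (by omega) (by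
    intro l hl
    have : ((i : ℕ) : ℤ) + 1 + l = ((i + 1 + l : ℕ) : ℤ) := by push_cast; ring
    rw [this]
    exact gg_zero _ _ _ (by omega) (by omega))
  have e : ((i : ℕ) : ℤ) + 1 + ((N + 1 - (i : ℕ) : ℕ) : ℤ) = ((N + 1 + 1 : ℕ) : ℤ) := by omega
  rw [e, gg_succ] at h
  have h2 := h.neg
  rw [neg_div, neg_neg] at h2
  refine h2.congr fun t => ?_
  rw [ee_eq k N t i (k + N + 2) (by omega), neg_div]

lemma cramer_mulVec' {m : ℕ} (A : Matrix (Fin m) (Fin m) ℝ) (x : Fin m → ℝ) :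
    cramer A (A *ᵥ x) = A.det • x := by
  rw [cramer_eq_adjugate_mulVec, mulVec_mulVec, adjugate_mul, smul_mulVec, one_mulVec]

lemma key_identity (k N : ℕ) (t : ℝ) :
    (k : ℝ) * Dn k (N + 1) t - deriv (Dn k (N + 1)) t = cramer (TM k N t) (ee k N t) 0 := by
  rw [(Dn_hasDerivAt k N t).deriv, ← cramer_apply]
  have hD : Dn k (N + 1) t = (TM k N t).det := rfl
  have e : ee k N t = (TM k N t) *ᵥ (fun j : Fin (N + 1) => - ww k (j + 1))
      - (fun i : Fin (N + 1) => aCoeff k (((i : ℕ) : ℤ) + 1) t) := by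
    funext i
    unfold ee
    rw [sum_range_succ', ww_zero]
    simp only [Pi.sub_apply, mulVec, dotProduct, TM, of_apply]
    rw [Fin.sum_univ_eq_sum_range
      (fun j => aCoeff k (((i : ℕ) : ℤ) - (j : ℤ)) t * - ww k (j + 1)) (N + 1)]
    simp only [mul_neg, sum_neg_distrib]
    have : ∀ m ∈ range (N + 1), ww k (m + 1) * aCoeff k (((i : ℕ) : ℤ) + 1 - ((m + 1 : ℕ) : ℤ)) t
        = aCoeff k (((i : ℕ) : ℤ) - (m : ℤ)) t * ww k (m + 1) := by
      intro m _
      rw [mul_comm]; congr 2; push_cast; ring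
    rw [sum_congr rfl this]
    simp
    ring
  rw [e, map_sub, cramer_mulVec', Pi.sub_apply, hD]
  simp [ww_one]
  ring

/-- rescaled Toeplitz matrix -/
noncomputable def TS (k N : ℕ) (t : ℝ) : Matrix (Fin (N + 1)) (Fin (N + 1)) ℝ :=
  Matrix.of fun i j => t ^ (i : ℕ) * ((t ^ (j : ℕ))⁻¹ * TM k N t i j)

/-- rescaled error vector -/
noncomputable def es (k N : ℕ) (t : ℝ) (i : Fin (N + 1)) : ℝ :=
  t ^ (i : ℕ) * (t ^ (N + 1))⁻¹ * ee k N t i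

lemma TS_eq (k N : ℕ) (t : ℝ) :
    TS k N t = diagonal (fun i : Fin (N + 1) => t ^ (i : ℕ)) * TM k N t * diagonal (fun i : Fin (N + 1) => (t ^ (i : ℕ))⁻¹) := by
  ext i j
  simp [TS, mul_diagonal, diagonal_mul]
  ring

lemma TS_det (k N : ℕ) (t : ℝ) (ht : t ≠ 0) : (TS k N t).det = (TM k N t).det := by
  rw [TS_eq, det_mul, det_mul, det_diagonal, det_diagonal, prod_inv_distrib]
  have : ∏ i : Fin (N + 1), t ^ (i : ℕ) ≠ 0 := prod_ne_zero_iff.2 fun i _ => pow_ne_zero _ ht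
  field_simp

lemma TS_cramer (k N : ℕ) (t : ℝ) (ht : t ≠ 0) :
    cramer (TS k N t) (es k N t) 0 = cramer (TM k N t) (ee k N t) 0 / t ^ (N + 1) := by
  have e : (TS k N t).updateCol 0 (t ^ (N + 1) • es k N t) =
      diagonal (fun i : Fin (N + 1) => t ^ (i : ℕ)) * (TM k N t).updateCol 0 (ee k N t) *
        diagonal (fun i : Fin (N + 1) => (t ^ (i : ℕ))⁻¹) := by
    ext i j
    have : t ^ (N + 1) ≠ 0 := pow_ne_zero _ ht
    by_cases hj : j = 0
    · subst hj
      simp [es, mul_diagonal, diagonal_mul]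
      field_simp
    · simp [updateCol_ne hj, TS, mul_diagonal, diagonal_mul]
      ring
  have h := congrArg det e
  rw [det_updateCol_smul, det_mul, det_mul, det_diagonal, det_diagonal, prod_inv_distrib] at h
  have h1 : ∏ i : Fin (N + 1), t ^ (i : ℕ) ≠ 0 := prod_ne_zero_iff.2 fun i _ => pow_ne_zero _ ht
  have h2 : t ^ (N + 1) ≠ 0 := pow_ne_zero _ ht
  rw [cramer_apply, cramer_apply, eq_div_iff h2, mul_comm, h]
  field_simp

/-- limit matrix -/
noncomputable def EM (N : ℕ) : Matrix (Fin (N + 1)) (Fin (N + 1)) ℝ :=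
  Matrix.of fun i j => if i ≤ j then ((Nat.factorial (j - i : ℕ) : ℝ))⁻¹ else 0

lemma EM_det (N : ℕ) : (EM N).det = 1 := by
  rw [det_of_isUpperTriangular]
  · simp [EM]
  · intro i j hij
    simp only [id] at hij
    simp [EM, not_le.2 hij]

lemma EM_mulVec (N : ℕ) :
    EM N *ᵥ (fun j : Fin (N + 1) => (-1) ^ (N - j : ℕ) / (Nat.factorial (N + 1 - j : ℕ) : ℝ)) =
      fun i : Fin (N + 1) => ((Nat.factorial (N + 1 - i : ℕ) : ℝ))⁻¹ := by
  funext i0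
  simp only [mulVec, dotProduct, EM, of_apply, Fin.le_def]
  rw [Fin.sum_univ_eq_sum_range (fun j => (if (i0 : ℕ) ≤ j then ((Nat.factorial (j - i0 : ℕ) : ℝ))⁻¹ else 0)
    * ((-1) ^ (N - j : ℕ) / (Nat.factorial (N + 1 - j : ℕ) : ℝ))) (N + 1)]
  have hi0 := i0.isLt
  generalize (i0 : ℕ) = i at *
  obtain ⟨d, hd⟩ : ∃ d, N = i + d := ⟨N - i, by omega⟩
  have hz : N + 1 = (i : ℕ) + (d + 1) := by omega
  rw [hz, sum_range_add, sum_eq_zero (s := range (i : ℕ)), zero_add]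
  · have h := Int.alternating_sum_range_choose_of_ne (n := d + 1) (by omega)
    have h' := congrArg (fun x : ℤ => (x : ℝ)) h
    push_cast at h'
    rw [sum_range_succ] at h'
    have hf : (Nat.factorial (d + 1) : ℝ) ≠ 0 := by positivity
    have e : ∀ x ∈ range (d + 1), (if (i : ℕ) ≤ i + x then ((Nat.factorial (i + x - i : ℕ) : ℝ))⁻¹ else 0)
        * ((-1) ^ (N - (i + x) : ℕ) / (Nat.factorial ((i : ℕ) + (d + 1) - (i + x) : ℕ) : ℝ)) =
        (-1) ^ d / (Nat.factorial (d + 1) : ℝ) * ((-1) ^ x * (Nat.choose (d + 1) x : ℝ)) := by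
      intro x hx
      have hx' : x ≤ d := by simp at hx; omega
      rw [if_pos (by omega), Nat.cast_choose ℝ (by omega : x ≤ d + 1)]
      have e1 : (i : ℕ) + x - i = x := by omega
      have e2 : N - (i + x) = d - x := by omega
      have e3 : (i : ℕ) + (d + 1) - (i + x) = d + 1 - x := by omega
      rw [e1, e2, e3]
      have e4 : (-1 : ℝ) ^ d = (-1) ^ (d - x) * (-1) ^ x := by rw [← pow_add]; congr 1; omega
      have e5 : (-1 : ℝ) ^ x * (-1) ^ x = 1 := by rw [← mul_pow]; simp
      have : (Nat.factorial x : ℝ) ≠ 0 := by positivity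
      have : (Nat.factorial (d + 1 - x) : ℝ) ≠ 0 := by positivity
      rw [e4]
      field_simp
      linear_combination - e5
    rw [sum_congr rfl e, ← mul_sum]
    have e6 : (-1 : ℝ) ^ d * (-1) ^ d = 1 := by rw [← mul_pow]; simp
    have e7 : (i : ℕ) + (d + 1) - i = d + 1 := by omega
    rw [e7]
    field_simp
    simp only [Nat.choose_self, Nat.cast_one, mul_one, pow_succ] at h'
    linear_combination (-1 : ℝ) ^ d * h' + e6
  · intro x hx
    rw [if_neg (by simp at hx; omega), zero_mul]

lemma TS_tendsto (k N : ℕ) (i j : Fin (N + 1)) :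
    Tendsto (fun t => TS k N t i j) (𝓝[≠] (0 : ℝ)) (𝓝 (EM N i j)) := by
  simp only [TS, EM, TM, of_apply]
  by_cases hij : i ≤ j
  · rw [if_pos hij]
    have hij' : (i : ℕ) ≤ j := hij
    have h := pA_tendsto (cc k) (k + N + 1) (((i : ℕ) : ℤ) - ((j : ℕ) : ℤ)) (j - i) (by omega) (by
      intro l hl
      unfold cc
      rw [if_neg (by omega)])
    have e : ((i : ℕ) : ℤ) - ((j : ℕ) : ℤ) + ((j - i : ℕ) : ℤ) = 0 := by omega
    have c0 : cc k 0 = 1 := by simp [cc]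
    rw [e, c0, one_div] at h
    refine h.congr' ?_
    filter_upwards [self_mem_nhdsWithin] with t ht
    rw [aCoeff_eq k (k + N + 1) _ t (by push_cast; omega)]
    have : t ^ (j : ℕ) = t ^ (i : ℕ) * t ^ (j - i : ℕ) := by rw [← pow_add]; congr 1; omega
    rw [this]
    have h1 : t ^ (i : ℕ) ≠ 0 := pow_ne_zero _ ht
    have h2 : t ^ (j - i : ℕ) ≠ 0 := pow_ne_zero _ ht
    field_simp
  · rw [if_neg hij]
    have hij' : (j : ℕ) < i := not_le.1 hij
    have hc : Continuous (fun t : ℝ => t ^ (i - j : ℕ) * aCoeff k (((i : ℕ) : ℤ) - ((j : ℕ) : ℤ)) t) := by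
      have : Continuous (aCoeff k (((i : ℕ) : ℤ) - ((j : ℕ) : ℤ))) :=
        continuous_iff_continuousAt.2 fun t => (aCoeff_hasDerivAt k _ t).continuousAt
      fun_prop
    have h := hc.tendsto 0
    rw [zero_pow (by omega), zero_mul] at h
    refine (h.mono_left nhdsWithin_le_nhds).congr' ?_
    filter_upwards [self_mem_nhdsWithin] with t ht
    have : t ^ (i : ℕ) = t ^ (j : ℕ) * t ^ (i - j : ℕ) := by rw [← pow_add]; congr 1; omega
    rw [this]
    have h1 : t ^ (j : ℕ) ≠ 0 := pow_ne_zero _ ht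
    field_simp

lemma es_tendsto (k N : ℕ) (i : Fin (N + 1)) :
    Tendsto (fun t => es k N t i) (𝓝[≠] (0 : ℝ))
      (𝓝 (ww k (N + 2) * ((Nat.factorial (N + 1 - i : ℕ) : ℝ))⁻¹)) := by
  refine (ee_tendsto k N i).congr' ?_
  filter_upwards [self_mem_nhdsWithin] with t ht
  unfold es
  have : t ^ (N + 1) = t ^ (i : ℕ) * t ^ (N + 1 - i : ℕ) := by rw [← pow_add]; congr 1; omega
  rw [this]
  have h1 : t ^ (i : ℕ) ≠ 0 := pow_ne_zero _ ht
  have h2 : t ^ (N + 1 - i : ℕ) ≠ 0 := pow_ne_zero _ ht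
  field_simp

lemma det_tendsto {m : ℕ} (A : ℝ → Matrix (Fin m) (Fin m) ℝ) (B : Matrix (Fin m) (Fin m) ℝ)
    (h : ∀ i j, Tendsto (fun t => A t i j) (𝓝[≠] (0 : ℝ)) (𝓝 (B i j))) :
    Tendsto (fun t => (A t).det) (𝓝[≠] (0 : ℝ)) (𝓝 B.det) := by
  have hA : Tendsto A (𝓝[≠] (0 : ℝ)) (𝓝 B) :=
    tendsto_pi_nhds.2 fun i => tendsto_pi_nhds.2 fun j => h i j
  exact ((continuous_id.matrix_det (n := Fin m) (R := ℝ)).tendsto B).comp hA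

lemma cramer_lim (k N : ℕ) :
    Tendsto (fun t => cramer (TS k N t) (es k N t) 0) (𝓝[≠] (0 : ℝ))
      (𝓝 (ww k (N + 2) * ((-1) ^ N / (Nat.factorial (N + 1) : ℝ)))) := by
  have h := det_tendsto (fun t => (TS k N t).updateCol 0 (es k N t))
    ((EM N).updateCol 0 (ww k (N + 2) • fun i : Fin (N + 1) => ((Nat.factorial (N + 1 - i : ℕ) : ℝ))⁻¹)) (by
      intro i j
      by_cases hj : j = 0
      · subst hj
        simpa using es_tendsto k N i
      · simpa [updateCol_ne hj] using TS_tendsto k N i j)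
  rw [det_updateCol_smul, ← EM_mulVec, ← cramer_apply, cramer_mulVec', EM_det] at h
  simpa [cramer_apply] using h

/-- Boundary behavior (4.15) of Tracy–Widom: as `t → 0`,
`σ(t) = (k/(n+1)!) C(n+k,n) t^{n+1} + O(t^{n+2})`; precisely,
`σ(t)/t^{n+1} → (k/(n+1)!) C(n+k,n)`. -/
theorem sigma_boundary_condition (k n : ℕ) (hk : 1 ≤ k) (hn : 1 ≤ n) :
    Filter.Tendsto (fun t : ℝ => sigmaFn k n t / t ^ (n + 1)) (𝓝[≠] (0 : ℝ))
      (𝓝 ((k : ℝ) / (Nat.factorial (n + 1) : ℝ) * (Nat.choose (n + k) n : ℝ))) := by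
  obtain ⟨N, rfl⟩ : ∃ N, n = N + 1 := ⟨n - 1, by omega⟩
  have hD : Tendsto (fun t => Dn k (N + 1) t) (𝓝[≠] (0 : ℝ)) (𝓝 1) := by
    have h := det_tendsto (TS k N) (EM N) (TS_tendsto k N)
    rw [EM_det] at h
    refine h.congr' ?_
    filter_upwards [self_mem_nhdsWithin] with t ht
    exact TS_det k N t ht
  have h := (cramer_lim k N).div hD one_ne_zero
  have hval : ww k (N + 2) * ((-1) ^ N / (Nat.factorial (N + 1) : ℝ)) / 1 =
      (k : ℝ) / (Nat.factorial (N + 1 + 1) : ℝ) * (Nat.choose (N + 1 + k) (N + 1) : ℝ) := by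
    rw [ww_eq, Nat.factorial_succ (N + 1)]
    have hc := Nat.choose_succ_right_eq (N + 1 + k) (N + 1)
    have hc' : (Nat.choose (N + 1 + k) (N + 1 + 1) : ℝ) * ((N : ℝ) + 1 + 1) =
        (Nat.choose (N + 1 + k) (N + 1) : ℝ) * k := by
      have e : N + 1 + k - (N + 1) = k := by omega
      rw [e] at hc
      exact_mod_cast hc
    have e6 : (-1 : ℝ) ^ (N + 1 + 1) * (-1) ^ N = 1 := by
      rw [← pow_add]; exact Even.neg_one_pow ⟨N + 1, by omega⟩
    have hf : (Nat.factorial (N + 1) : ℝ) ≠ 0 := by positivity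
    have hn2 : ((N : ℝ) + 1 + 1) ≠ 0 := by positivity
    rw [add_comm k (N + 1)]
    push_cast
    field_simp
    linear_combination hc' + (Nat.choose (N + 1 + k) (N + 1 + 1) : ℝ) * ((N : ℝ) + 1 + 1) * e6
  rw [hval] at h
  refine h.congr' ?_
  filter_upwards [self_mem_nhdsWithin, hD.eventually_ne one_ne_zero] with t ht hDt
  have ht' : t ≠ 0 := ht
  simp only [Pi.div_apply]
  rw [TS_cramer k N t ht, ← key_identity]
  unfold sigmaFn
  rw [pow_succ t (N + 1)]
  have : t ^ (N + 1) ≠ 0 := pow_ne_zero _ ht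
  field_simp
end
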